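/- For every nonnegative integer t, the H-trees H(2 + t; 7 + 2t, 6 + 2t; 5 + t, 1), H(1 + 2t; 6 + 4t, 5 + 4t; 1 + 2t, 2), and H(2 + 2t; 8 + 4t, 7 + 4t; 3 + 2t, 1), i.e., the corresponding double starlike trees DS(2 + t; 7 + 2t, 6 + 2t; 5 + t, 1), DS(1 + 2t; 6 + 4t, 5 + 4t; 1 + 2t, 2), and DS(2 + 2t; 8 + 4t, 7 + 4t; 3 + 2t, 1), are all transmission irregular. -/

import Mathlib

/-- The transmission of a vertex: sum of distances to all other vertices. -/
noncomputable def transmission {V : Type*} [Fintype V] (G : SimpleGraph V) (u : V) : ℕ :=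
  ∑ v : V, G.dist u v

/-- A graph is transmission irregular if all vertices have distinct transmissions. -/
def TransmissionIrregular {V : Type*} [Fintype V] (G : SimpleGraph V) : Prop :=
  Function.Injective (transmission G)

/-- The double starlike tree `DS(C; A; B)`: an internal path `Sum.inl 0, …, Sum.inl C`
of length `C`, with `k` pendent paths of lengths `A i` attached at `Sum.inl 0`
(vertices `Sum.inr (Sum.inl ⟨i, j⟩)`), and `m` pendent paths of lengths `B i`
attached at `Sum.inl C` (vertices `Sum.inr (Sum.inr ⟨i, j⟩)`). -/
def doubleStarlikeTree (C k m : ℕ) (A : Fin k → ℕ) (B : Fin m → ℕ) :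
    SimpleGraph (Fin (C + 1) ⊕ ((i : Fin k) × Fin (A i)) ⊕ ((i : Fin m) × Fin (B i))) :=
  SimpleGraph.fromRel (fun x y =>
    match x, y with
    | Sum.inl c, Sum.inl c' => c.val + 1 = c'.val
    | Sum.inl c, Sum.inr (Sum.inl ⟨_, j⟩) => c.val = 0 ∧ j.val = 0
    | Sum.inl c, Sum.inr (Sum.inr ⟨_, j⟩) => c.val = C ∧ j.val = 0
    | Sum.inr (Sum.inl ⟨i, j⟩), Sum.inr (Sum.inl ⟨i', j'⟩) => i.val = i'.val ∧ j.val + 1 = j'.val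
    | Sum.inr (Sum.inr ⟨i, j⟩), Sum.inr (Sum.inr ⟨i', j'⟩) => i.val = i'.val ∧ j.val + 1 = j'.val
    | _, _ => False)

/-- A function that vanishes on the diagonal, grows by at most one along edges, and can always be
decreased by moving to a neighbour is the graph distance. -/
theorem SimpleGraph.dist_eq_of_descent {V : Type*} (G : SimpleGraph V) (d : V → V → ℕ)
    (hself : ∀ x, d x x = 0) (hlip : ∀ x y z, G.Adj y z → d x z ≤ d x y + 1)
    (hdesc : ∀ x y, x ≠ y → ∃ z, G.Adj z y ∧ d x z + 1 = d x y) (x y : V) :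
    G.dist x y = d x y := by
  have lower : ∀ {a b : V} (p : G.Walk a b) (x : V), d x b ≤ d x a + p.length := by
    intro a b p
    induction p with
    | nil => simp
    | cons h p ih =>
      intro x
      have h₁ := ih x
      have h₂ := hlip x _ _ h
      rw [SimpleGraph.Walk.length_cons]
      omega
  have upper : ∀ (n : ℕ) (y : V), d x y = n → ∃ p : G.Walk x y, p.length = n := by
    intro n
    induction n with
    | zero =>
      intro y hy
      by_cases hxy : x = y
      · subst hxy
        exact ⟨SimpleGraph.Walk.nil, rfl⟩
      · obtain ⟨z, -, hz⟩ := hdesc x y hxy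
        omega
    | succ n ih =>
      intro y hy
      have hxy : x ≠ y := by
        rintro rfl
        simp [hself] at hy
      obtain ⟨z, hadj, hz⟩ := hdesc x y hxy
      obtain ⟨p, hp⟩ := ih z (by omega)
      exact ⟨p.concat hadj, by simp [hp]⟩
  obtain ⟨p, hp⟩ := upper _ y rfl
  refine le_antisymm (hp ▸ SimpleGraph.dist_le p) ?_
  obtain ⟨q, hq⟩ := p.reachable.exists_walk_length_eq_dist
  have := lower q x
  rw [hself, hq] at this
  omega

/-- The distance between two vertices of a double starlike tree, read off from their positions. -/
def doubleStarlikeDist (C k m : ℕ) (A : Fin k → ℕ) (B : Fin m → ℕ) :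
    Fin (C + 1) ⊕ ((i : Fin k) × Fin (A i)) ⊕ ((i : Fin m) × Fin (B i)) →
    Fin (C + 1) ⊕ ((i : Fin k) × Fin (A i)) ⊕ ((i : Fin m) × Fin (B i)) → ℕ
  | Sum.inl c, Sum.inl c' => (c.val - c'.val) + (c'.val - c.val)
  | Sum.inl c, Sum.inr (Sum.inl ⟨_, j⟩) => c.val + (j.val + 1)
  | Sum.inl c, Sum.inr (Sum.inr ⟨_, j⟩) => (C - c.val) + (j.val + 1)
  | Sum.inr (Sum.inl ⟨_, j⟩), Sum.inl c => c.val + (j.val + 1)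
  | Sum.inr (Sum.inl ⟨i, j⟩), Sum.inr (Sum.inl ⟨i', j'⟩) =>
      if i = i' then (j.val - j'.val) + (j'.val - j.val) else (j.val + 1) + (j'.val + 1)
  | Sum.inr (Sum.inl ⟨_, j⟩), Sum.inr (Sum.inr ⟨_, j'⟩) => C + (j.val + 1) + (j'.val + 1)
  | Sum.inr (Sum.inr ⟨_, j⟩), Sum.inl c => (C - c.val) + (j.val + 1)
  | Sum.inr (Sum.inr ⟨_, j⟩), Sum.inr (Sum.inl ⟨_, j'⟩) => C + (j.val + 1) + (j'.val + 1)
  | Sum.inr (Sum.inr ⟨i, j⟩), Sum.inr (Sum.inr ⟨i', j'⟩) =>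
      if i = i' then (j.val - j'.val) + (j'.val - j.val) else (j.val + 1) + (j'.val + 1)

section Distance

variable {C k m : ℕ} {A : Fin k → ℕ} {B : Fin m → ℕ}

theorem doubleStarlikeTree_adj_inl {c c' : Fin (C + 1)} (h : c.val + 1 = c'.val) :
    (doubleStarlikeTree C k m A B).Adj (Sum.inl c) (Sum.inl c') := by
  refine ⟨fun e => ?_, Or.inl h⟩
  have := congrArg Fin.val (Sum.inl.inj e)
  omega

theorem doubleStarlikeTree_adj_left {i : Fin k} {j j' : Fin (A i)} (h : j.val + 1 = j'.val) :
    (doubleStarlikeTree C k m A B).Adj (Sum.inr (Sum.inl ⟨i, j⟩)) (Sum.inr (Sum.inl ⟨i, j'⟩)) := by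
  refine ⟨fun e => ?_, Or.inl ⟨rfl, h⟩⟩
  have : j = j' := by simpa using e
  omega

theorem doubleStarlikeTree_adj_right {i : Fin m} {j j' : Fin (B i)} (h : j.val + 1 = j'.val) :
    (doubleStarlikeTree C k m A B).Adj (Sum.inr (Sum.inr ⟨i, j⟩)) (Sum.inr (Sum.inr ⟨i, j'⟩)) := by
  refine ⟨fun e => ?_, Or.inl ⟨rfl, h⟩⟩
  have : j = j' := by simpa using e
  omega

theorem doubleStarlikeTree_adj_inl_left {c : Fin (C + 1)} {i : Fin k} {j : Fin (A i)}
    (hc : c.val = 0) (hj : j.val = 0) :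
    (doubleStarlikeTree C k m A B).Adj (Sum.inl c) (Sum.inr (Sum.inl ⟨i, j⟩)) :=
  ⟨by simp, Or.inl ⟨hc, hj⟩⟩

theorem doubleStarlikeTree_adj_inl_right {c : Fin (C + 1)} {i : Fin m} {j : Fin (B i)}
    (hc : c.val = C) (hj : j.val = 0) :
    (doubleStarlikeTree C k m A B).Adj (Sum.inl c) (Sum.inr (Sum.inr ⟨i, j⟩)) :=
  ⟨by simp, Or.inl ⟨hc, hj⟩⟩

theorem doubleStarlikeDist_le_succ_of_adj
    (x y z : Fin (C + 1) ⊕ ((i : Fin k) × Fin (A i)) ⊕ ((i : Fin m) × Fin (B i)))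
    (h : (doubleStarlikeTree C k m A B).Adj y z) :
    doubleStarlikeDist C k m A B x z ≤ doubleStarlikeDist C k m A B x y + 1 := by
  obtain ⟨-, h⟩ := h
  rcases x with a | ⟨i, a⟩ | ⟨i, a⟩ <;> rcases y with b | ⟨i', b⟩ | ⟨i', b⟩ <;>
    rcases z with c | ⟨i'', c⟩ | ⟨i'', c⟩ <;>
    simp only [doubleStarlikeDist, or_false, false_or, or_self, Fin.val_inj] at h ⊢ <;>
    (try split_ifs) <;> grind

theorem exists_adj_doubleStarlikeDist_succ
    (x y : Fin (C + 1) ⊕ ((i : Fin k) × Fin (A i)) ⊕ ((i : Fin m) × Fin (B i))) (hxy : x ≠ y) :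
    ∃ z, (doubleStarlikeTree C k m A B).Adj z y ∧
      doubleStarlikeDist C k m A B x z + 1 = doubleStarlikeDist C k m A B x y := by
  rcases y with c | ⟨i, j⟩ | ⟨i, j⟩
  · have down (h : 0 < c.val) : (doubleStarlikeTree C k m A B).Adj
        (Sum.inl ⟨c.val - 1, by omega⟩) (Sum.inl c) :=
      doubleStarlikeTree_adj_inl (by simp; omega)
    have up (h : c.val < C) : (doubleStarlikeTree C k m A B).Adj
        (Sum.inl ⟨c.val + 1, by omega⟩) (Sum.inl c) :=
      (doubleStarlikeTree_adj_inl (by simp)).symm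
    rcases x with a | ⟨i, a⟩ | ⟨i, a⟩
    · have hne : a.val ≠ c.val := fun e => hxy (congrArg _ (Fin.ext e))
      rcases lt_or_gt_of_ne hne with h | h
      · exact ⟨_, down (by omega), by simp only [doubleStarlikeDist]; omega⟩
      · exact ⟨_, up (by omega), by simp only [doubleStarlikeDist]; omega⟩
    · by_cases h : c.val = 0
      · exact ⟨_, (doubleStarlikeTree_adj_inl_left (j := ⟨0, a.pos⟩) h rfl).symm,
          by simp only [doubleStarlikeDist, if_true]; omega⟩
      · exact ⟨_, down (by omega), by simp only [doubleStarlikeDist]; omega⟩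
    · by_cases h : c.val = C
      · exact ⟨_, (doubleStarlikeTree_adj_inl_right (j := ⟨0, a.pos⟩) h rfl).symm,
          by simp only [doubleStarlikeDist, if_true]; omega⟩
      · exact ⟨_, up (by omega), by simp only [doubleStarlikeDist]; omega⟩
  · have up (h : j.val + 1 < A i) : (doubleStarlikeTree C k m A B).Adj
        (Sum.inr (Sum.inl ⟨i, ⟨j.val + 1, h⟩⟩)) (Sum.inr (Sum.inl ⟨i, j⟩)) :=
      (doubleStarlikeTree_adj_left rfl).symm
    by_cases h : ∃ a : Fin (A i), x = Sum.inr (Sum.inl ⟨i, a⟩) ∧ j.val < a.val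
    · obtain ⟨a, rfl, h⟩ := h
      exact ⟨_, up (by omega), by simp only [doubleStarlikeDist, if_true]; omega⟩
    · have inner (i') (a : Fin (A i')) (hx : x = Sum.inr (Sum.inl ⟨i', a⟩)) (hi : i' = i) :
          a.val < j.val := by
        subst hx hi
        have hne : a.val ≠ j.val := fun e => hxy (by rw [Fin.ext e])
        by_contra hlt
        exact h ⟨a, rfl, by omega⟩
      by_cases hj : j.val = 0
      · refine ⟨_, doubleStarlikeTree_adj_inl_left (c := 0) rfl hj, ?_⟩
        rcases x with a | ⟨i', a⟩ | ⟨i', a⟩ <;> simp only [doubleStarlikeDist] <;>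
          grind
      · refine ⟨_, doubleStarlikeTree_adj_left (j := ⟨j.val - 1, by omega⟩) (by simp; omega), ?_⟩
        rcases x with a | ⟨i', a⟩ | ⟨i', a⟩ <;> simp only [doubleStarlikeDist] <;>
          grind
  · have up (h : j.val + 1 < B i) : (doubleStarlikeTree C k m A B).Adj
        (Sum.inr (Sum.inr ⟨i, ⟨j.val + 1, h⟩⟩)) (Sum.inr (Sum.inr ⟨i, j⟩)) :=
      (doubleStarlikeTree_adj_right rfl).symm
    by_cases h : ∃ a : Fin (B i), x = Sum.inr (Sum.inr ⟨i, a⟩) ∧ j.val < a.val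
    · obtain ⟨a, rfl, h⟩ := h
      exact ⟨_, up (by omega), by simp only [doubleStarlikeDist, if_true]; omega⟩
    · have inner (i') (a : Fin (B i')) (hx : x = Sum.inr (Sum.inr ⟨i', a⟩)) (hi : i' = i) :
          a.val < j.val := by
        subst hx hi
        have hne : a.val ≠ j.val := fun e => hxy (by rw [Fin.ext e])
        by_contra hlt
        exact h ⟨a, rfl, by omega⟩
      by_cases hj : j.val = 0
      · refine ⟨_, doubleStarlikeTree_adj_inl_right (c := Fin.last C) rfl hj, ?_⟩
        rcases x with a | ⟨i', a⟩ | ⟨i', a⟩ <;> simp only [doubleStarlikeDist] <;>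
          grind
      · refine ⟨_, doubleStarlikeTree_adj_right (j := ⟨j.val - 1, by omega⟩) (by simp; omega), ?_⟩
        rcases x with a | ⟨i', a⟩ | ⟨i', a⟩ <;> simp only [doubleStarlikeDist] <;>
          grind

theorem doubleStarlikeTree_dist
    (x y : Fin (C + 1) ⊕ ((i : Fin k) × Fin (A i)) ⊕ ((i : Fin m) × Fin (B i))) :
    (doubleStarlikeTree C k m A B).dist x y = doubleStarlikeDist C k m A B x y := by
  refine SimpleGraph.dist_eq_of_descent _ _ (fun x => ?_) doubleStarlikeDist_le_succ_of_adj
    exists_adj_doubleStarlikeDist_succ x y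
  rcases x with a | ⟨i, a⟩ | ⟨i, a⟩ <;> simp [doubleStarlikeDist]

end Distance

theorem two_mul_sum_dist_outside (n : ℕ) (c : ℤ) :
    2 * ∑ j : Fin n, (c + ((j.val : ℤ) + 1)) = n * (2 * c + n + 1) := by
  rw [Fin.sum_univ_eq_sum_range (fun j => c + ((j : ℤ) + 1))]
  induction n with
  | zero => simp
  | succ n ih =>
    rw [Finset.sum_range_succ, mul_add, ih]
    push_cast
    ring

theorem two_mul_sum_dist_inside (n i : ℕ) (hi : i ≤ n) :
    2 * ∑ j : Fin n, (((i - j.val : ℕ) : ℤ) + ((j.val - i : ℕ) : ℤ)) =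
      i * (i + 1) + (n - 1 - i) * (n - i) := by
  rw [Fin.sum_univ_eq_sum_range (fun j => ((i - j : ℕ) : ℤ) + ((j - i : ℕ) : ℤ))]
  induction n, hi using Nat.le_induction with
  | base =>
    have h : ∀ j ∈ Finset.range i,
        ((i - j : ℕ) : ℤ) + ((j - i : ℕ) : ℤ) = (i : ℤ) - j := by
      intro j hj
      rw [Finset.mem_range] at hj
      omega
    have key : ∀ n : ℕ, 2 * ∑ j ∈ Finset.range n, ((i : ℤ) - j) = n * (2 * i - n + 1) := by
      intro n
      induction n with
      | zero => simp
      | succ n ih =>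
        rw [Finset.sum_range_succ, mul_add, ih]
        push_cast
        ring
    rw [Finset.sum_congr rfl h, key]
    ring
  | succ n hn ih =>
    rw [Finset.sum_range_succ, mul_add, ih, Nat.sub_eq_zero_of_le hn, Nat.cast_sub hn]
    push_cast
    ring

theorem two_mul_sum_val_add (n : ℕ) (a : ℤ) :
    2 * ∑ c : Fin n, ((c.val : ℤ) + a) = n * (2 * a + n - 1) := by
  have h := two_mul_sum_dist_outside n (a - 1)
  rw [Finset.sum_congr rfl fun c _ => (by ring : (c.val : ℤ) + a = a - 1 + ((c.val : ℤ) + 1)), h]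
  ring

theorem two_mul_sum_sub_val_add (n : ℕ) (a : ℤ) :
    2 * ∑ c : Fin (n + 1), (((n - c.val : ℕ) : ℤ) + a) = (n + 1) * (2 * a + n) := by
  have h := two_mul_sum_val_add (n + 1) a
  rw [← Equiv.sum_comp Fin.revPerm] at h
  simp only [Fin.revPerm_apply, Fin.val_rev, Nat.add_sub_add_right] at h
  rw [h]
  push_cast
  ring

section Transmission

variable {C : ℕ} {A B : Fin 2 → ℕ} {N s : ℕ}

theorem two_mul_transmission_doubleStarlikeTree
    (x : Fin (C + 1) ⊕ ((i : Fin 2) × Fin (A i)) ⊕ ((i : Fin 2) × Fin (B i))) :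
    (2 * transmission (doubleStarlikeTree C 2 2 A B) x : ℤ) =
      2 * ∑ c, (doubleStarlikeDist C 2 2 A B x (Sum.inl c) : ℤ) +
      ((2 * ∑ j, (doubleStarlikeDist C 2 2 A B x (Sum.inr (Sum.inl ⟨0, j⟩)) : ℤ) +
        2 * ∑ j, (doubleStarlikeDist C 2 2 A B x (Sum.inr (Sum.inl ⟨1, j⟩)) : ℤ)) +
       (2 * ∑ j, (doubleStarlikeDist C 2 2 A B x (Sum.inr (Sum.inr ⟨0, j⟩)) : ℤ) +
        2 * ∑ j, (doubleStarlikeDist C 2 2 A B x (Sum.inr (Sum.inr ⟨1, j⟩)) : ℤ))) := by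
  simp only [transmission, doubleStarlikeTree_dist, Fintype.sum_sum_type, Fintype.sum_sigma,
    Fin.sum_univ_two, Nat.cast_add, Nat.cast_sum, mul_add]

theorem two_mul_transmission_inl (c : Fin (C + 1)) :
    (2 * transmission (doubleStarlikeTree C 2 2 A B) (Sum.inl c) : ℤ) =
      c * (c + 1) + (C - c) * (C + 1 - c) +
      (A 0 * (2 * c + A 0 + 1) + A 1 * (2 * c + A 1 + 1) +
        (B 0 * (2 * (C - c) + B 0 + 1) + B 1 * (2 * (C - c) + B 1 + 1))) := by
  have hc : ((C - c.val : ℕ) : ℤ) = C - c := by omega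
  have h := two_mul_sum_dist_inside (C + 1) c.val (by omega)
  simp only [two_mul_transmission_doubleStarlikeTree, doubleStarlikeDist, Nat.cast_add,
    Nat.cast_one, two_mul_sum_dist_outside, h, hc]
  ring

theorem transmission_inl (hN : C + 1 + A 0 + A 1 + B 0 + B 1 = N)
    (hs : 2 * (C + B 0 + B 1) + 1 + s = N) (c : Fin (C + 1)) :
    transmission (doubleStarlikeTree C 2 2 A B) (Sum.inl c) =
      transmission (doubleStarlikeTree C 2 2 A B) (Sum.inl 0) + c * (c + s) := by
  have hs : (s : ℤ) = A 0 + A 1 - C - B 0 - B 1 := by omega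
  refine Nat.cast_injective (R := ℤ) (mul_left_cancel₀ two_ne_zero ?_)
  rw [Nat.cast_add, mul_add, two_mul_transmission_inl, two_mul_transmission_inl]
  push_cast [hs]
  simp only [Fin.val_zero, Nat.cast_zero]
  ring

theorem transmission_left (hN : C + 1 + A 0 + A 1 + B 0 + B 1 = N) (i : Fin 2)
    (hs : 2 * A i + 1 + s = N) (j : Fin (A i)) :
    transmission (doubleStarlikeTree C 2 2 A B) (Sum.inr (Sum.inl ⟨i, j⟩)) =
      transmission (doubleStarlikeTree C 2 2 A B) (Sum.inl 0) + (j + 1) * (j + 1 + s) := by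
  have hs : (s : ℤ) = C + A 0 + A 1 + B 0 + B 1 - 2 * A i := by omega
  have h := two_mul_sum_dist_inside (A i) j.val j.is_lt.le
  refine Nat.cast_injective (R := ℤ) (mul_left_cancel₀ two_ne_zero ?_)
  rw [Nat.cast_add, mul_add, two_mul_transmission_inl, two_mul_transmission_doubleStarlikeTree]
  match i with
  | 0 | 1 =>
    simp only [doubleStarlikeDist, if_true, zero_ne_one, one_ne_zero, if_false, Nat.cast_add,
      Nat.cast_mul, Nat.cast_one, two_mul_sum_dist_outside, two_mul_sum_val_add, h, hs,
      Fin.val_zero, Nat.cast_zero]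
    ring

theorem transmission_right (hN : C + 1 + A 0 + A 1 + B 0 + B 1 = N) (i : Fin 2)
    (hs : 2 * B i + 1 + s = N) (j : Fin (B i)) :
    transmission (doubleStarlikeTree C 2 2 A B) (Sum.inr (Sum.inr ⟨i, j⟩)) =
      transmission (doubleStarlikeTree C 2 2 A B) (Sum.inl (Fin.last C)) +
        (j + 1) * (j + 1 + s) := by
  have hs : (s : ℤ) = C + A 0 + A 1 + B 0 + B 1 - 2 * B i := by omega
  have h := two_mul_sum_dist_inside (B i) j.val j.is_lt.le
  refine Nat.cast_injective (R := ℤ) (mul_left_cancel₀ two_ne_zero ?_)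
  rw [Nat.cast_add, mul_add, two_mul_transmission_inl, two_mul_transmission_doubleStarlikeTree]
  match i with
  | 0 | 1 =>
    simp only [doubleStarlikeDist, if_true, zero_ne_one, one_ne_zero, if_false, Nat.cast_add,
      Nat.cast_mul, Nat.cast_one, two_mul_sum_dist_outside,
      two_mul_sum_sub_val_add, h, hs, Fin.val_last, sub_self]
    ring

end Transmission

theorem mul_add_injective {k l s : ℕ} (h : k * (k + s) = l * (l + s)) : k = l := by
  rcases lt_trichotomy k l with hkl | hkl | hkl
  · nlinarith
  · exact hkl
  · nlinarith

/-- An `H`-tree in which the transmission excesses along distinct branches never coincide is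
transmission irregular. Here `sC`, `sA i`, `sB i` are the constants for which the excess of a
vertex at distance `k` from the start of its branch is `k * (k + s)`. -/
theorem transmissionIrregular_of_branches_ne {C : ℕ} {A B : Fin 2 → ℕ} {N sC : ℕ}
    {sA sB : Fin 2 → ℕ} (hN : C + 1 + A 0 + A 1 + B 0 + B 1 = N)
    (hC : 2 * (C + B 0 + B 1) + 1 + sC = N) (hA : ∀ i, 2 * A i + 1 + sA i = N)
    (hB : ∀ i, 2 * B i + 1 + sB i = N)
    (hAA : ∀ k l, 1 ≤ k → k ≤ A 0 → 1 ≤ l → l ≤ A 1 → k * (k + sA 0) ≠ l * (l + sA 1))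
    (hBB : ∀ k l, 1 ≤ k → k ≤ B 0 → 1 ≤ l → l ≤ B 1 → k * (k + sB 0) ≠ l * (l + sB 1))
    (hCA : ∀ c i l, c ≤ C → 1 ≤ l → l ≤ A i → c * (c + sC) ≠ l * (l + sA i))
    (hAB : ∀ i i' l k, 1 ≤ l → l ≤ A i → 1 ≤ k → k ≤ B i' →
      l * (l + sA i) ≠ C * (C + sC) + k * (k + sB i')) :
    TransmissionIrregular (doubleStarlikeTree C 2 2 A B) := by
  have inl := transmission_inl hN hC
  have left := fun i => transmission_left hN i (hA i)
  have right := fun i => transmission_right hN i (hB i)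
  simp only [inl (Fin.last C), Fin.val_last, add_assoc (transmission _ _)] at right
  have hCB : ∀ (c : Fin (C + 1)) (k s : ℕ),
      c.val * (c.val + sC) < C * (C + sC) + (k + 1) * (k + 1 + s) := by
    intro c k s
    have : c.val * (c.val + sC) ≤ C * (C + sC) := by gcongr <;> omega
    have : 0 < (k + 1) * (k + 1 + s) := by positivity
    omega
  have hAA' : ∀ (i i' : Fin 2) (j : Fin (A i)) (j' : Fin (A i')),
      (j.val + 1) * (j.val + 1 + sA i) = (j'.val + 1) * (j'.val + 1 + sA i') → i = i' := by
    intro i i' j j' h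
    match i, i' with
    | 0, 0 | 1, 1 => rfl
    | 0, 1 => exact absurd h (hAA _ _ (by omega) j.is_lt (by omega) j'.is_lt)
    | 1, 0 => exact absurd h.symm (hAA _ _ (by omega) j'.is_lt (by omega) j.is_lt)
  have hBB' : ∀ (i i' : Fin 2) (j : Fin (B i)) (j' : Fin (B i')),
      (j.val + 1) * (j.val + 1 + sB i) = (j'.val + 1) * (j'.val + 1 + sB i') → i = i' := by
    intro i i' j j' h
    match i, i' with
    | 0, 0 | 1, 1 => rfl
    | 0, 1 => exact absurd h (hBB _ _ (by omega) j.is_lt (by omega) j'.is_lt)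
    | 1, 0 => exact absurd h.symm (hBB _ _ (by omega) j'.is_lt (by omega) j.is_lt)
  rintro (c | ⟨i, j⟩ | ⟨i, j⟩) (c' | ⟨i', j'⟩ | ⟨i', j'⟩) h
  · replace h := Nat.add_left_cancel (((inl c).symm.trans h).trans (inl c'))
    rw [Fin.ext (mul_add_injective h)]
  · replace h := Nat.add_left_cancel (((inl c).symm.trans h).trans (left i' j'))
    exact absurd h (hCA _ _ _ (by omega) (by omega) j'.is_lt)
  · replace h := Nat.add_left_cancel (((inl c).symm.trans h).trans (right i' j'))
    exact absurd h (hCB _ _ _).ne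
  · replace h := Nat.add_left_cancel (((left i j).symm.trans h).trans (inl c'))
    exact absurd h.symm (hCA _ _ _ (by omega) (by omega) j.is_lt)
  · replace h := Nat.add_left_cancel (((left i j).symm.trans h).trans (left i' j'))
    obtain rfl := hAA' _ _ _ _ h
    rw [Fin.ext (Nat.succ_injective (mul_add_injective h))]
  · replace h := Nat.add_left_cancel (((left i j).symm.trans h).trans (right i' j'))
    exact absurd h (hAB _ _ _ _ (by omega) j.is_lt (by omega) j'.is_lt)
  · replace h := Nat.add_left_cancel (((right i j).symm.trans h).trans (inl c'))
    exact absurd h (hCB _ _ _).ne'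
  · replace h := Nat.add_left_cancel (((right i j).symm.trans h).trans (left i' j'))
    exact absurd h.symm (hAB _ _ _ _ (by omega) j'.is_lt (by omega) j.is_lt)
  · replace h := Nat.add_left_cancel (((right i j).symm.trans h).trans (right i' j'))
    obtain rfl := hBB' _ _ _ _ (Nat.add_left_cancel h)
    rw [Fin.ext (Nat.succ_injective (mul_add_injective (Nat.add_left_cancel h)))]

/-- Branches whose excesses differ in slope by two never have equal excesses. -/
theorem mul_add_ne_mul_add_two (k s : ℕ) {l : ℕ} (hl : 1 ≤ l) :
    k * (k + s) ≠ l * (l + (s + 2)) := by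
  intro h
  rcases le_or_gt k l with hkl | hkl <;> nlinarith

/-- If the excesses of two branches differ in slope by four, then they coincide in at most one
place besides the start. -/
theorem eq_of_mul_add_eq_mul_add_four {k l s : ℕ} (hpos : 0 < k + l)
    (h : k * (k + s) = l * (l + (s + 4))) : k = l + 1 ∧ 2 * l = s + 1 := by
  rcases lt_trichotomy k (l + 1) with hk | rfl | hk
  · nlinarith
  · exact ⟨rfl, by linarith⟩
  · nlinarith

theorem transmissionIrregular_hTree_add_five_one (t : ℕ) :
    TransmissionIrregular
      (doubleStarlikeTree (2 + t) 2 2 ![7 + 2 * t, 6 + 2 * t] ![5 + t, 1]) := by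
  refine transmissionIrregular_of_branches_ne (N := 22 + 6 * t) (sC := 5 + 2 * t)
    (sA := ![7 + 2 * t, 9 + 2 * t]) (sB := ![11 + 4 * t, 19 + 6 * t]) ?_ ?_ ?_ ?_ ?_ ?_ ?_ ?_
  all_goals simp only [Fin.forall_fin_two, Matrix.cons_val_zero, Matrix.cons_val_one]
  · ring
  · ring
  · constructor <;> ring
  · constructor <;> ring
  · intro k l _ _ hl _ h
    exact mul_add_ne_mul_add_two k (7 + 2 * t) hl (by linarith)
  · intro k l hk _ hl hl' h
    obtain rfl : l = 1 := by omega
    rcases le_or_gt k 1 with h₁ | h₁ <;> nlinarith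
  · refine fun c => ⟨fun l hc hl _ h => ?_, fun l hc hl _ h => ?_⟩
    · exact mul_add_ne_mul_add_two c (5 + 2 * t) hl (by linarith)
    · have := eq_of_mul_add_eq_mul_add_four (k := c) (l := l) (s := 5 + 2 * t) (by omega)
        (by linarith)
      omega
  · refine ⟨⟨fun l k hl _ hk _ h => ?_, fun l k _ _ hk hk' h => ?_⟩,
      fun l k hl _ hk _ h => ?_, fun l k _ _ hk hk' h => ?_⟩
    · rcases le_or_gt l (k + t + 1) with h₁ | h₁ <;> nlinarith
    · obtain rfl : k = 1 := by omega
      rcases le_or_gt l (t + 3) with h₁ | h₁ <;> nlinarith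
    · rcases le_or_gt l (k + t + 1) with h₁ | h₁ <;> nlinarith
    · obtain rfl : k = 1 := by omega
      rcases le_or_gt l (t + 2) with h₁ | h₁ <;> nlinarith

theorem transmissionIrregular_hTree_odd_two (t : ℕ) :
    TransmissionIrregular
      (doubleStarlikeTree (1 + 2 * t) 2 2 ![6 + 4 * t, 5 + 4 * t] ![1 + 2 * t, 2]) := by
  refine transmissionIrregular_of_branches_ne (N := 16 + 12 * t) (sC := 7 + 4 * t)
    (sA := ![3 + 4 * t, 5 + 4 * t]) (sB := ![13 + 8 * t, 11 + 12 * t]) ?_ ?_ ?_ ?_ ?_ ?_ ?_ ?_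
  all_goals simp only [Fin.forall_fin_two, Matrix.cons_val_zero, Matrix.cons_val_one]
  · ring
  · ring
  · constructor <;> ring
  · constructor <;> ring
  · intro k l _ _ hl _ h
    exact mul_add_ne_mul_add_two k (3 + 4 * t) hl (by linarith)
  · intro k l hk _ hl hl' h
    obtain rfl | rfl : l = 1 ∨ l = 2 := by omega
    all_goals
      obtain rfl | rfl | h₁ : k = 1 ∨ k = 2 ∨ 3 ≤ k := by omega
      · omega
      · omega
      · nlinarith
  · refine fun c => ⟨fun l hc hl _ h => ?_, fun l hc hl _ h => ?_⟩
    · have := eq_of_mul_add_eq_mul_add_four (k := l) (l := c) (s := 3 + 4 * t) (by omega)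
        (by linarith)
      omega
    · rcases Nat.eq_zero_or_pos c with rfl | hc₀
      · nlinarith
      · exact mul_add_ne_mul_add_two l (5 + 4 * t) hc₀ (by linarith)
  · refine ⟨⟨fun l k hl hl' hk hk' h => ?_, fun l k _ _ hk hk' h => ?_⟩,
      fun l k hl hl' hk hk' h => ?_, fun l k _ _ hk hk' h => ?_⟩
    · obtain h₁ | rfl | rfl | rfl | h₁ : k + 5 + 2 * t ≤ l ∨ l = k + 4 + 2 * t ∨
        l = k + 3 + 2 * t ∨ l = k + 2 + 2 * t ∨ l ≤ k + 1 + 2 * t := by omega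
      · nlinarith
      · ring_nf at h
        omega
      · ring_nf at h
        omega
      · ring_nf at h
        omega
      · nlinarith
    · obtain rfl | rfl : k = 1 ∨ k = 2 := by omega
      · rcases le_or_gt l (2 * t + 3) with h₁ | h₁ <;> nlinarith
      · rcases le_or_gt l (2 * t + 4) with h₁ | h₁ <;> nlinarith
    · obtain h₁ | rfl | rfl | h₁ : k + 4 + 2 * t ≤ l ∨ l = k + 3 + 2 * t ∨
        l = k + 2 + 2 * t ∨ l ≤ k + 1 + 2 * t := by omega
      · nlinarith
      · ring_nf at h
        omega
      · ring_nf at h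
        omega
      · nlinarith
    · obtain rfl | rfl : k = 1 ∨ k = 2 := by omega
      · rcases le_or_gt l (2 * t + 2) with h₁ | h₁ <;> nlinarith
      · obtain h₁ | rfl | h₁ : l ≤ 2 * t + 3 ∨ l = 2 * t + 4 ∨ 2 * t + 5 ≤ l := by omega
        · nlinarith
        · ring_nf at h
          omega
        · nlinarith

theorem transmissionIrregular_hTree_odd_one (t : ℕ) :
    TransmissionIrregular
      (doubleStarlikeTree (2 + 2 * t) 2 2 ![8 + 4 * t, 7 + 4 * t] ![3 + 2 * t, 1]) := by
  refine transmissionIrregular_of_branches_ne (N := 22 + 12 * t) (sC := 9 + 4 * t)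
    (sA := ![5 + 4 * t, 7 + 4 * t]) (sB := ![15 + 8 * t, 19 + 12 * t]) ?_ ?_ ?_ ?_ ?_ ?_ ?_ ?_
  all_goals simp only [Fin.forall_fin_two, Matrix.cons_val_zero, Matrix.cons_val_one]
  · ring
  · ring
  · constructor <;> ring
  · constructor <;> ring
  · intro k l _ _ hl _ h
    exact mul_add_ne_mul_add_two k (5 + 4 * t) hl (by linarith)
  · intro k l hk _ hl hl' h
    obtain rfl : l = 1 := by omega
    rcases le_or_gt k 1 with h₁ | h₁ <;> nlinarith
  · refine fun c => ⟨fun l hc hl _ h => ?_, fun l hc hl _ h => ?_⟩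
    · have := eq_of_mul_add_eq_mul_add_four (k := l) (l := c) (s := 5 + 4 * t) (by omega)
        (by linarith)
      omega
    · rcases Nat.eq_zero_or_pos c with rfl | hc₀
      · nlinarith
      · exact mul_add_ne_mul_add_two l (7 + 4 * t) hc₀ (by linarith)
  · refine ⟨⟨fun l k hl hl' hk hk' h => ?_, fun l k _ _ hk hk' h => ?_⟩,
      fun l k hl hl' hk hk' h => ?_, fun l k _ _ hk hk' h => ?_⟩
    · obtain h₁ | rfl | rfl | h₁ : k + 5 + 2 * t ≤ l ∨ l = k + 4 + 2 * t ∨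
        l = k + 3 + 2 * t ∨ l ≤ k + 2 + 2 * t := by omega
      · nlinarith
      · ring_nf at h
        omega
      · ring_nf at h
        omega
      · nlinarith
    · obtain rfl : k = 1 := by omega
      rcases le_or_gt l (2 * t + 4) with h₁ | h₁ <;> nlinarith
    · obtain h₁ | rfl | h₁ : k + 4 + 2 * t ≤ l ∨ l = k + 3 + 2 * t ∨ l ≤ k + 2 + 2 * t := by omega
      · nlinarith
      · ring_nf at h
        omega
      · nlinarith
    · obtain rfl : k = 1 := by omega
      rcases le_or_gt l (2 * t + 3) with h₁ | h₁ <;> nlinarith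

/-- For every nonnegative integer `t`, the H-trees `H(2+t; 7+2t, 6+2t; 5+t, 1)`,
`H(1+2t; 6+4t, 5+4t; 1+2t, 2)`, and `H(2+2t; 8+4t, 7+4t; 3+2t, 1)` are all
transmission irregular. -/
theorem hTree_families_two_three_four_TI (t : ℕ) :
    TransmissionIrregular
      (doubleStarlikeTree (2 + t) 2 2 ![7 + 2 * t, 6 + 2 * t] ![5 + t, 1]) ∧
    TransmissionIrregular
      (doubleStarlikeTree (1 + 2 * t) 2 2 ![6 + 4 * t, 5 + 4 * t] ![1 + 2 * t, 2]) ∧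
    TransmissionIrregular
      (doubleStarlikeTree (2 + 2 * t) 2 2 ![8 + 4 * t, 7 + 4 * t] ![3 + 2 * t, 1]) :=
  ⟨transmissionIrregular_hTree_add_five_one t, transmissionIrregular_hTree_odd_two t,
    transmissionIrregular_hTree_odd_one t⟩
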